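/- Let d ≥ 1 be an integer and take the exponent p = 4, i.e. define v_β(ω) = (1−β²)^{d/8}·(1 − β·ω_{d+1})^{−d/4} for β ∈ (−1,1). Then for every β ∈ (0,1), writing γ(β) = 2β/(1+β²), one has ∫_{𝕊^d} (v_β + v_{−β})⁴ dσ = 2·|𝕊^d| + 8·∫_{𝕊^d} v_{γ(β)} dσ + 6·∫_{𝕊^d} v_{γ(β)}² dσ. -/

import Mathlib

open MeasureTheory Real

/-- The Sobolev optimizer `v_β(ω) = (1-β²)^{d/(2p)} (1 - β ω_{d+1})^{-d/p}` on `𝕊^d`. -/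
noncomputable def vb (d : ℕ) (p β : ℝ) (ω : EuclideanSpace ℝ (Fin (d+1))) : ℝ :=
  (1 - β^2) ^ ((d:ℝ)/(2*p)) * (1 - β * ω (Fin.last d)) ^ (-(d:ℝ)/p)

open scoped NNReal ENNReal

lemma slice {X : Type*} [MetricSpace X] [MeasurableSpace X] [BorelSpace X] (d : ℕ)
    (T : X ≃ᵐ X) (ρ : X → ℝ≥0) (hρ : Measurable ρ) (hpos : ∀ x, 0 < ρ x)
    (hT : ∀ x y, dist (T x) (T y) ^ 2 = ρ x * ρ y * dist x y ^ 2)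
    (l : ℝ≥0) (hl : 1 < l) (A : Set X) (hA : MeasurableSet A) :
    (μH[(d:ℝ)] : Measure X) (T '' A) ≤ (l:ℝ≥0∞)^d * ∫⁻ x in A, (ρ x : ℝ≥0∞)^d ∂μH[(d:ℝ)] := by
  let B : ℤ → Set X := fun k => A ∩ ρ ⁻¹' (Set.Ico (l^k) (l^(k+1)))
  have hl0 : (0:ℝ≥0) < l := lt_trans one_pos hl
  have hB : ∀ k, MeasurableSet (B k) := fun k => hA.inter (hρ measurableSet_Ico)
  have hAU : A = ⋃ k, B k := by
    ext x
    simp only [B, Set.mem_iUnion, Set.mem_inter_iff, Set.mem_preimage]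
    constructor
    · intro hx
      obtain ⟨k, hk⟩ := exists_mem_Ico_zpow (hpos x) hl
      exact ⟨k, hx, hk⟩
    · rintro ⟨k, hx, -⟩; exact hx
  have hdisj : Pairwise (Function.onFun Disjoint B) := by
    intro i j hij
    have : Disjoint (Set.Ico (l^i) (l^(i+1))) (Set.Ico (l^j) (l^(j+1))) := by
      rw [Set.disjoint_left]
      rintro z ⟨h1, h2⟩ ⟨h3, h4⟩
      have a := (zpow_lt_zpow_iff_right₀ hl).1 (h1.trans_lt h4)
      have b := (zpow_lt_zpow_iff_right₀ hl).1 (h3.trans_lt h2)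
      omega
    exact (this.preimage ρ).mono Set.inter_subset_right Set.inter_subset_right
  have hslice : ∀ k, (μH[(d:ℝ)] : Measure X) (T '' (B k)) ≤
      (l:ℝ≥0∞)^d * ∫⁻ x in B k, (ρ x : ℝ≥0∞)^d ∂μH[(d:ℝ)] := by
    intro k
    have hlip : LipschitzOnWith (l^(k+1)) T (B k) := by
      apply LipschitzOnWith.of_dist_le_mul
      rintro x ⟨-, hx⟩ y ⟨-, hy⟩
      apply le_of_sq_le_sq _ (by positivity)
      rw [hT, mul_pow, sq ((l^(k+1) : ℝ≥0) : ℝ)]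
      have h1 : (ρ x : ℝ) ≤ (l^(k+1) : ℝ≥0) := NNReal.coe_le_coe.2 hx.2.le
      have h2 : (ρ y : ℝ) ≤ (l^(k+1) : ℝ≥0) := NNReal.coe_le_coe.2 hy.2.le
      gcongr
    calc _ ≤ ((l^(k+1) : ℝ≥0) : ℝ≥0∞)^(d:ℝ) * μH[(d:ℝ)] (B k) :=
          hlip.hausdorffMeasure_image_le (Nat.cast_nonneg d)
      _ = (l:ℝ≥0∞)^d * (((l^k : ℝ≥0) : ℝ≥0∞)^d * μH[(d:ℝ)] (B k)) := by
          rw [ENNReal.rpow_natCast, zpow_add_one₀ hl0.ne', ENNReal.coe_mul, mul_pow]; ring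
      _ ≤ _ := by
          gcongr
          rw [← setLIntegral_const]
          apply setLIntegral_mono' (hB k)
          rintro x ⟨-, hx⟩
          gcongr
          exact hx.1
  calc _ = (μH[(d:ℝ)] : Measure X) (⋃ k, T '' (B k)) := by rw [← Set.image_iUnion, ← hAU]
    _ ≤ ∑' k, (μH[(d:ℝ)] : Measure X) (T '' (B k)) := measure_iUnion_le _
    _ ≤ ∑' k, (l:ℝ≥0∞)^d * ∫⁻ x in B k, (ρ x : ℝ≥0∞)^d ∂μH[(d:ℝ)] := ENNReal.tsum_le_tsum hslice
    _ = _ := by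
      rw [ENNReal.tsum_mul_left, ← lintegral_iUnion hB hdisj, ← hAU]

lemma one_side {X : Type*} [MetricSpace X] [MeasurableSpace X] [BorelSpace X] (d : ℕ)
    (T : X ≃ᵐ X) (ρ : X → ℝ≥0) (hρ : Measurable ρ) (hpos : ∀ x, 0 < ρ x)
    (hT : ∀ x y, dist (T x) (T y) ^ 2 = ρ x * ρ y * dist x y ^ 2) :
    (μH[(d:ℝ)] : Measure X).map T.symm ≤
      (μH[(d:ℝ)] : Measure X).withDensity (fun x => (ρ x : ℝ≥0∞)^d) := by
  rw [Measure.le_iff]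
  intro A hA
  rw [T.symm.map_apply, withDensity_apply _ hA, ← T.image_eq_preimage_symm]
  have h := slice d T ρ hρ hpos hT
  have ht : Filter.Tendsto (fun l : ℝ≥0 => (l:ℝ≥0∞)^d * ∫⁻ x in A, (ρ x : ℝ≥0∞)^d ∂μH[(d:ℝ)])
      (nhdsWithin 1 (Set.Ioi 1)) (nhds (((1:ℝ≥0):ℝ≥0∞)^d * ∫⁻ x in A, (ρ x : ℝ≥0∞)^d ∂μH[(d:ℝ)])) := by
    apply ENNReal.Tendsto.mul_const
    · apply Filter.Tendsto.mono_left _ nhdsWithin_le_nhds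
      exact ((ENNReal.continuous_pow d).comp ENNReal.continuous_coe).tendsto 1
    · left; simp
  simp only [ENNReal.coe_one, one_pow, one_mul] at ht
  refine ge_of_tendsto ht ?_
  filter_upwards [self_mem_nhdsWithin] with l hl
  exact h l hl A hA

lemma two_side {X : Type*} [MetricSpace X] [MeasurableSpace X] [BorelSpace X] (d : ℕ)
    (T : X ≃ᵐ X) (ρ : X → ℝ≥0) (hρ : Measurable ρ) (hpos : ∀ x, 0 < ρ x)
    (hT : ∀ x y, dist (T x) (T y) ^ 2 = ρ x * ρ y * dist x y ^ 2) :
    (μH[(d:ℝ)] : Measure X).map T.symm =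
      (μH[(d:ℝ)] : Measure X).withDensity (fun x => (ρ x : ℝ≥0∞)^d) := by
  apply le_antisymm (one_side d T ρ hρ hpos hT)
  have h2 := one_side d T.symm (fun x => (ρ (T.symm x))⁻¹) (hρ.comp T.symm.measurable).inv
    (fun x => inv_pos.2 (hpos _)) (by
      intro x y
      have h := hT (T.symm x) (T.symm y)
      rw [T.apply_symm_apply, T.apply_symm_apply] at h
      rw [h]
      have a := (hpos (T.symm x)).ne'
      have b := (hpos (T.symm y)).ne'
      push_cast
      field_simp)
  rw [T.symm_symm] at h2
  have hm : Measurable (fun x => (ρ x : ℝ≥0∞)^d) := (hρ.coe_nnreal_ennreal).pow_const d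
  rw [Measure.le_iff]
  intro A hA
  rw [T.symm.map_apply, withDensity_apply _ hA, ← lintegral_indicator hA]
  have h3 : Measurable (fun y => A.indicator (fun x => (ρ x : ℝ≥0∞)^d) (T.symm y)) :=
    (hm.indicator hA).comp T.symm.measurable
  calc ∫⁻ x, A.indicator (fun x => (ρ x : ℝ≥0∞)^d) x ∂μH[(d:ℝ)]
      = ∫⁻ y, A.indicator (fun x => (ρ x : ℝ≥0∞)^d) (T.symm y) ∂((μH[(d:ℝ)] : Measure X).map T) := by
        rw [lintegral_map h3 T.measurable]; simp
    _ ≤ _ := lintegral_mono' h2 le_rfl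
    _ = ∫⁻ y, (T.symm ⁻¹' A).indicator 1 y ∂μH[(d:ℝ)] := by
        rw [lintegral_withDensity_eq_lintegral_mul _ _ h3]
        · apply lintegral_congr
          intro y
          by_cases hy : T.symm y ∈ A
          · have : (ρ (T.symm y)) ≠ 0 := (hpos _).ne'
            simp only [Pi.mul_apply, Set.indicator_of_mem hy]
            rw [Set.indicator_of_mem (by exact hy), Pi.one_apply, ← mul_pow, ← ENNReal.coe_mul, inv_mul_cancel₀ this]
            simp
          · simp only [Pi.mul_apply, Set.indicator_of_notMem hy]
            rw [Set.indicator_of_notMem (by exact hy), mul_zero]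
        · exact ((hρ.comp T.symm.measurable).inv.coe_nnreal_ennreal).pow_const d
    _ = _ := lintegral_indicator_one (T.symm.measurable hA)

lemma cov {X : Type*} [MetricSpace X] [MeasurableSpace X] [BorelSpace X] (d : ℕ)
    (T : X ≃ᵐ X) (ρ : X → ℝ≥0) (hρ : Measurable ρ) (hpos : ∀ x, 0 < ρ x)
    (hT : ∀ x y, dist (T x) (T y) ^ 2 = ρ x * ρ y * dist x y ^ 2) (f : X → ℝ) :
    ∫ x, (ρ x : ℝ)^d * f (T x) ∂(μH[(d:ℝ)] : Measure X) = ∫ x, f x ∂μH[(d:ℝ)] := by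
  have h := two_side d T ρ hρ hpos hT
  have h1 : ∫ x, f (T x) ∂((μH[(d:ℝ)] : Measure X).map T.symm) = ∫ x, f x ∂μH[(d:ℝ)] := by
    rw [T.symm.measurableEmbedding.integral_map]; simp
  rw [← h1, h]
  have := integral_withDensity_eq_integral_smul (μ := (μH[(d:ℝ)] : Measure X))
    (hρ.pow_const d) (fun x => f (T x))
  simp only [ENNReal.coe_pow] at this
  rw [this]
  rfl

section geometry
variable {d : ℕ}

noncomputable def eL (d : ℕ) : EuclideanSpace ℝ (Fin (d+1)) := EuclideanSpace.single (Fin.last d) 1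

noncomputable def Tm (d : ℕ) (b : ℝ) (x : EuclideanSpace ℝ (Fin (d+1))) :
    EuclideanSpace ℝ (Fin (d+1)) :=
  (1 - b * x (Fin.last d))⁻¹ • (√(1 - b^2) • x +
    (x (Fin.last d) - b - √(1 - b^2) * x (Fin.last d)) • eL d)

lemma Tm_apply (b : ℝ) (x : EuclideanSpace ℝ (Fin (d+1))) (i : Fin (d+1)) :
    Tm d b x i = (1 - b * x (Fin.last d))⁻¹ * (√(1 - b^2) * x i +
    (x (Fin.last d) - b - √(1 - b^2) * x (Fin.last d)) * eL d i) := by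
  simp [Tm]
  ring

lemma eL_last : eL d (Fin.last d) = 1 := by simp [eL]

lemma Tm_last (b : ℝ) (x : EuclideanSpace ℝ (Fin (d+1))) :
    Tm d b x (Fin.last d) = (x (Fin.last d) - b) / (1 - b * x (Fin.last d)) := by
  rw [Tm_apply, eL_last]; ring

lemma last_abs (x : EuclideanSpace ℝ (Fin (d+1))) (hx : ‖x‖ = 1) : |x (Fin.last d)| ≤ 1 := by
  rw [← hx, ← Real.norm_eq_abs]
  exact PiLp.norm_apply_le x _

lemma den_pos {b : ℝ} (hb : |b| < 1) (x : EuclideanSpace ℝ (Fin (d+1))) (hx : ‖x‖ = 1) :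
    0 < 1 - b * x (Fin.last d) := by
  have h := last_abs x hx
  have : |b * x (Fin.last d)| < 1 := by
    rw [abs_mul]
    nlinarith [abs_nonneg b, abs_nonneg (x (Fin.last d))]
  linarith [le_abs_self (b * x (Fin.last d))]

lemma sq_pos' {b : ℝ} (hb : |b| < 1) : 0 < 1 - b^2 := by
  have := (sq_lt_one_iff_abs_lt_one b).2 hb
  linarith

lemma inner_eL (x : EuclideanSpace ℝ (Fin (d+1))) : inner ℝ x (eL d) = x (Fin.last d) := by
  simp [eL, EuclideanSpace.inner_single_right]

lemma inner_eL' (x : EuclideanSpace ℝ (Fin (d+1))) : inner ℝ (eL d) x = x (Fin.last d) := by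
  simp [eL, EuclideanSpace.inner_single_left]

lemma Tm_inner {b : ℝ} (hb : |b| < 1) (x y : EuclideanSpace ℝ (Fin (d+1)))
    (hx : ‖x‖ = 1) (hy : ‖y‖ = 1) :
    1 - inner ℝ (Tm d b x) (Tm d b y) =
      (√(1 - b^2) / (1 - b * x (Fin.last d))) * (√(1 - b^2) / (1 - b * y (Fin.last d)))
      * (1 - inner ℝ x y) := by
  have h1 := (den_pos hb x hx).ne'
  have h2 := (den_pos hb y hy).ne'
  have hc : √(1 - b^2) ^ 2 = 1 - b^2 := Real.sq_sqrt (sq_pos' hb).le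
  unfold Tm
  simp only [inner_smul_left, inner_smul_right, inner_add_left, inner_add_right, inner_eL,
    inner_eL', eL_last]
  simp only [conj_trivial]
  generalize √(1 - b^2) = c at *
  generalize x (Fin.last d) = t at *
  generalize y (Fin.last d) = s at *
  generalize inner ℝ x y = z at *
  field_simp
  linear_combination (t * s - 1) * hc

lemma Tm_norm {b : ℝ} (hb : |b| < 1) (x : EuclideanSpace ℝ (Fin (d+1)))
    (hx : ‖x‖ = 1) : ‖Tm d b x‖ = 1 := by
  have h := Tm_inner hb x x hx hx
  rw [real_inner_self_eq_norm_sq, real_inner_self_eq_norm_sq, hx] at h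
  have : ‖Tm d b x‖ ^ 2 = 1 := by linarith
  nlinarith [norm_nonneg (Tm d b x)]

lemma Tm_dist {b : ℝ} (hb : |b| < 1) (x y : EuclideanSpace ℝ (Fin (d+1)))
    (hx : ‖x‖ = 1) (hy : ‖y‖ = 1) :
    dist (Tm d b x) (Tm d b y) ^ 2 =
      (√(1 - b^2) / (1 - b * x (Fin.last d))) * (√(1 - b^2) / (1 - b * y (Fin.last d)))
      * dist x y ^ 2 := by
  rw [dist_eq_norm, dist_eq_norm, norm_sub_sq_real, norm_sub_sq_real, hx, hy, Tm_norm hb x hx,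
    Tm_norm hb y hy]
  linear_combination 2 * Tm_inner hb x y hx hy

lemma Tm_inv {b : ℝ} (hb : |b| < 1) (x : EuclideanSpace ℝ (Fin (d+1)))
    (hx : ‖x‖ = 1) : Tm d (-b) (Tm d b x) = x := by
  have h1 := (den_pos hb x hx).ne'
  have hc : √(1 - b^2) ^ 2 = 1 - b^2 := Real.sq_sqrt (sq_pos' hb).le
  have h3 := (sq_pos' hb).ne'
  have key : 1 + b * ((x (Fin.last d) - b) / (1 - b * x (Fin.last d)))
      = (1 - b^2) / (1 - b * x (Fin.last d)) := by field_simp; ring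
  ext i
  rw [Tm_apply, Tm_last, Tm_apply, neg_sq, neg_mul, sub_neg_eq_add, key]
  generalize √(1 - b^2) = c at *
  generalize x (Fin.last d) = t at *
  generalize x i = z at *
  field_simp
  linear_combination (z - t * eL d i) * hc

lemma nS (x : Metric.sphere (0 : EuclideanSpace ℝ (Fin (d+1))) 1) :
    ‖(x : EuclideanSpace ℝ (Fin (d+1)))‖ = 1 := norm_eq_of_mem_sphere x

lemma Tm_cont {b : ℝ} (hb : |b| < 1) : Continuous
    (fun x : Metric.sphere (0 : EuclideanSpace ℝ (Fin (d+1))) 1 => Tm d b x) := by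
  unfold Tm
  have h0 : Continuous (fun x : Metric.sphere (0 : EuclideanSpace ℝ (Fin (d+1))) 1 =>
    (x : EuclideanSpace ℝ (Fin (d+1))) (Fin.last d)) := by fun_prop
  have h : Continuous (fun x : Metric.sphere (0 : EuclideanSpace ℝ (Fin (d+1))) 1 =>
    (1 - b * (x : EuclideanSpace ℝ (Fin (d+1))) (Fin.last d))⁻¹) :=
    Continuous.inv₀ (by fun_prop) (fun x => (den_pos hb x.1 (nS x)).ne')
  fun_prop

noncomputable def Th (d : ℕ) {b : ℝ} (hb : |b| < 1) :
    Metric.sphere (0 : EuclideanSpace ℝ (Fin (d+1))) 1 ≃ₜ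
      Metric.sphere (0 : EuclideanSpace ℝ (Fin (d+1))) 1 where
  toFun x := ⟨Tm d b x, mem_sphere_zero_iff_norm.2 (Tm_norm hb x.1 (nS x))⟩
  invFun x := ⟨Tm d (-b) x, mem_sphere_zero_iff_norm.2 (Tm_norm (b := -b) (by simpa using hb) x.1 (nS x))⟩
  left_inv x := Subtype.ext (Tm_inv hb x.1 (nS x))
  right_inv x := Subtype.ext (by
    have := Tm_inv (b := -b) (by simpa using hb) (x : EuclideanSpace ℝ (Fin (d+1))) (nS x)
    rwa [neg_neg] at this)
  continuous_toFun := (Tm_cont hb).subtype_mk _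
  continuous_invFun := (Tm_cont (b := -b) (by simpa using hb)).subtype_mk _

lemma sphere_cov {b : ℝ} (hb : |b| < 1) (f : EuclideanSpace ℝ (Fin (d+1)) → ℝ) :
    ∫ x : Metric.sphere (0 : EuclideanSpace ℝ (Fin (d+1))) 1,
      (√(1 - b^2) / (1 - b * (x : EuclideanSpace ℝ (Fin (d+1))) (Fin.last d)))^d
        * f (Tm d b x) ∂μH[(d:ℝ)] =
    ∫ x : Metric.sphere (0 : EuclideanSpace ℝ (Fin (d+1))) 1, f x ∂μH[(d:ℝ)] := by
  have hp : ∀ x : Metric.sphere (0 : EuclideanSpace ℝ (Fin (d+1))) 1,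
      0 < √(1 - b^2) / (1 - b * (x : EuclideanSpace ℝ (Fin (d+1))) (Fin.last d)) := fun x =>
    div_pos (Real.sqrt_pos.2 (sq_pos' hb)) (den_pos hb x.1 (nS x))
  exact cov d (Th d hb).toMeasurableEquiv
    (fun x => ⟨√(1 - b^2) / (1 - b * (x : EuclideanSpace ℝ (Fin (d+1))) (Fin.last d)), (hp x).le⟩)
    (by
      apply Measurable.subtype_mk
      fun_prop)
    (fun x => hp x)
    (fun x y => Tm_dist hb x.1 y.1 (nS x) (nS y)) (fun x => f x)

lemma vb_pos {b p : ℝ} (hb : |b| < 1) (x : EuclideanSpace ℝ (Fin (d+1))) (hx : ‖x‖ = 1) :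
    0 < vb d p b x :=
  mul_pos (Real.rpow_pos_of_pos (sq_pos' hb) _) (Real.rpow_pos_of_pos (den_pos hb x hx) _)

lemma vb_four {b : ℝ} (hb : |b| < 1) (x : EuclideanSpace ℝ (Fin (d+1))) (hx : ‖x‖ = 1) :
    vb d 4 b x ^ 4 = (√(1 - b^2) / (1 - b * x (Fin.last d)))^d := by
  have h1 := den_pos hb x hx
  have h2 := sq_pos' hb
  unfold vb
  rw [mul_pow, div_pow, Real.sqrt_eq_rpow, ← Real.rpow_mul_natCast h2.le,
    ← Real.rpow_mul_natCast h1.le, ← Real.rpow_mul_natCast h2.le, ← Real.rpow_natCast _ d,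
    div_eq_mul_inv (_ ^ _) (_ ^ _), ← Real.rpow_neg h1.le]
  congr 2
  · push_cast; ring
  · push_cast; ring

lemma gamma_abs {b : ℝ} (hb : |b| < 1) : |2 * b / (1 + b^2)| < 1 := by
  have h2 : 0 < 1 + b^2 := by positivity
  rw [abs_lt] at *
  constructor
  · rw [lt_div_iff₀ h2]; nlinarith [mul_pos (by linarith : 0 < 1 + b) (by linarith : 0 < 1 + b)]
  · rw [div_lt_iff₀ h2]; nlinarith [mul_pos (by linarith : 0 < 1 - b) (by linarith : 0 < 1 - b)]

lemma vb_comp {b : ℝ} (hb : |b| < 1) (x : EuclideanSpace ℝ (Fin (d+1))) (hx : ‖x‖ = 1) :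
    vb d 4 b x * vb d 4 (-(2 * b / (1 + b^2))) (Tm d b x) = vb d 4 (-b) x := by
  have h1 := den_pos hb x hx
  have h1' := den_pos (b := -b) (by simpa using hb) x hx
  have h2 := sq_pos' hb
  have h3 : 0 < 1 + b^2 := by positivity
  unfold vb
  rw [Tm_last]
  generalize x (Fin.last d) = t at *
  have e1 : 1 - (-(2 * b / (1 + b^2)))^2 = ((1 - b^2) / (1 + b^2))^2 := by field_simp; ring
  have e2 : 1 - -(2 * b / (1 + b^2)) * ((t - b) / (1 - b * t)) =
      ((1 - b^2) / (1 + b^2)) * ((1 - -b * t) / (1 - b * t)) := by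
    have := h1.ne'
    field_simp; ring
  have h4 : 0 < (1 - b^2) / (1 + b^2) := by positivity
  have h5 : 0 < (1 - -b * t) / (1 - b * t) := by positivity
  rw [e1, e2, neg_sq, Real.mul_rpow h4.le h5.le, Real.div_rpow h1'.le h1.le,
    ← Real.rpow_natCast_mul h4.le]
  have e3 : ((1 - b^2) / (1 + b^2)) ^ (((2:ℕ):ℝ) * ((d:ℝ)/(2*4))) *
     ((1 - b^2) / (1 + b^2)) ^ (-(d:ℝ)/4) = 1 := by
    rw [← Real.rpow_add h4]
    convert Real.rpow_zero _ using 2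
    push_cast; ring
  have h6 := (Real.rpow_pos_of_pos h1 (-(d:ℝ)/4)).ne'
  generalize ((1 - b^2) / (1 + b^2)) ^ (((2:ℕ):ℝ) * ((d:ℝ)/(2*4))) = A at *
  generalize ((1 - b^2) / (1 + b^2)) ^ (-(d:ℝ)/4) = B at *
  generalize (1 - b * t) ^ (-(d:ℝ)/4) = C at *
  generalize (1 - -b * t) ^ (-(d:ℝ)/4) = D at *
  field_simp
  linear_combination D * e3

lemma vb_cont {b : ℝ} (hb : |b| < 1) : Continuous
    (fun x : Metric.sphere (0 : EuclideanSpace ℝ (Fin (d+1))) 1 => vb d 4 b x) := by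
  unfold vb
  apply Continuous.mul continuous_const
  exact Continuous.rpow_const (by fun_prop) (fun x => Or.inl (den_pos hb x.1 (nS x)).ne')

lemma main_k {b : ℝ} (hb : |b| < 1) (k : ℕ) (hk : k ≤ 4) :
    ∫ x : Metric.sphere (0 : EuclideanSpace ℝ (Fin (d+1))) 1,
      vb d 4 b x ^ (4 - k) * vb d 4 (-b) x ^ k ∂μH[(d:ℝ)] =
    ∫ x : Metric.sphere (0 : EuclideanSpace ℝ (Fin (d+1))) 1,
      vb d 4 (-(2 * b / (1 + b^2))) x ^ k ∂μH[(d:ℝ)] := by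
  rw [← sphere_cov hb (fun y => vb d 4 (-(2 * b / (1 + b^2))) y ^ k)]
  congr 1
  ext x
  rw [← vb_four hb x.1 (nS x), ← vb_comp hb x.1 (nS x), mul_pow, ← mul_assoc, ← pow_add,
    Nat.sub_add_cancel hk]

lemma vb_neg (b : ℝ) (x : EuclideanSpace ℝ (Fin (d+1))) : vb d 4 b (-x) = vb d 4 (-b) x := by
  simp [vb]

lemma refl_k (b : ℝ) (k : ℕ) :
    ∫ x : Metric.sphere (0 : EuclideanSpace ℝ (Fin (d+1))) 1, vb d 4 (-b) x ^ k ∂μH[(d:ℝ)] =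
    ∫ x : Metric.sphere (0 : EuclideanSpace ℝ (Fin (d+1))) 1, vb d 4 b x ^ k ∂μH[(d:ℝ)] := by
  let e : Metric.sphere (0 : EuclideanSpace ℝ (Fin (d+1))) 1 ≃ᵢ
      Metric.sphere (0 : EuclideanSpace ℝ (Fin (d+1))) 1 :=
    { toEquiv := Equiv.neg _
      isometry_toFun := by
        apply Isometry.of_dist_eq
        intro x y
        simp [Subtype.dist_eq] }
  have h := (e.measurePreserving_hausdorffMeasure (d:ℝ)).integral_comp
    e.toHomeomorph.measurableEmbedding
    (fun x : Metric.sphere (0 : EuclideanSpace ℝ (Fin (d+1))) 1 => vb d 4 b x ^ k)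
  rw [← h]
  congr 1
  ext x
  rw [← vb_neg]
  rfl

lemma int_zero (hinf : (μH[(d:ℝ)] : Measure (Metric.sphere (0 : EuclideanSpace ℝ (Fin (d+1))) 1)) Set.univ = ⊤)
    (f : Metric.sphere (0 : EuclideanSpace ℝ (Fin (d+1))) 1 → ℝ) (hf : Continuous f)
    (hpos : ∀ x, 0 < f x) : ∫ x, f x ∂μH[(d:ℝ)] = 0 := by
  apply integral_undef
  intro hi
  have : Nonempty (Metric.sphere (0 : EuclideanSpace ℝ (Fin (d+1))) 1) :=
    ⟨⟨eL d, by simp [eL]⟩⟩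
  obtain ⟨x0, -, h0⟩ := isCompact_univ.exists_isMinOn Set.univ_nonempty hf.continuousOn
  have h1 : Integrable (fun _ : Metric.sphere (0 : EuclideanSpace ℝ (Fin (d+1))) 1 => f x0)
      μH[(d:ℝ)] := by
    refine hi.mono' aestronglyMeasurable_const (Filter.Eventually.of_forall fun x => ?_)
    rw [Real.norm_eq_abs, abs_of_pos (hpos _)]
    exact h0 (Set.mem_univ x)
  rw [integrable_const_iff] at h1
  rcases h1 with h1 | h1
  · exact (hpos x0).ne' h1
  · exact (measure_ne_top _ Set.univ) hinf

lemma set_int (f : EuclideanSpace ℝ (Fin (d+1)) → ℝ) :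
    ∫ ω in Metric.sphere (0 : EuclideanSpace ℝ (Fin (d+1))) 1, f ω ∂μH[(d:ℝ)] =
    ∫ x : Metric.sphere (0 : EuclideanSpace ℝ (Fin (d+1))) 1, f x ∂μH[(d:ℝ)] := by
  have h := (isometry_subtype_coe (s := Metric.sphere (0 : EuclideanSpace ℝ (Fin (d+1))) 1)).map_hausdorffMeasure
    (d := (d:ℝ)) (Or.inl (Nat.cast_nonneg d))
  rw [Subtype.range_coe] at h
  rw [← h, (MeasurableEmbedding.subtype_coe Metric.isClosed_sphere.measurableSet).integral_map]

end geometry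

/-- For `p = 4`: `∫_{𝕊^d} (v_β + v_{-β})⁴ dσ = 2|𝕊^d| + 8 ∫ v_{γ(β)} dσ + 6 ∫ v_{γ(β)}² dσ`
with `γ(β) = 2β/(1+β²)`. -/
theorem fourth_power_of_two_bubbles (d : ℕ) (hd : 1 ≤ d) (β : ℝ)
    (hβ : β ∈ Set.Ioo (0:ℝ) 1) :
    (∫ ω in Metric.sphere (0 : EuclideanSpace ℝ (Fin (d+1))) 1,
        (vb d 4 β ω + vb d 4 (-β) ω)^4 ∂μH[(d:ℝ)])
      = 2 * (μH[(d:ℝ)] (Metric.sphere (0 : EuclideanSpace ℝ (Fin (d+1))) 1)).toReal +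
        8 * (∫ ω in Metric.sphere (0 : EuclideanSpace ℝ (Fin (d+1))) 1,
              vb d 4 (2 * β / (1 + β^2)) ω ∂μH[(d:ℝ)]) +
        6 * ∫ ω in Metric.sphere (0 : EuclideanSpace ℝ (Fin (d+1))) 1,
              vb d 4 (2 * β / (1 + β^2)) ω ^ 2 ∂μH[(d:ℝ)] := by
  have hb : |β| < 1 := by rw [abs_lt]; constructor <;> linarith [hβ.1, hβ.2]
  have hb' : |-β| < 1 := by simpa using hb
  have hg := gamma_abs hb
  have hvol : (μH[(d:ℝ)] (Metric.sphere (0 : EuclideanSpace ℝ (Fin (d+1))) 1)).toReal =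
      ∫ x : Metric.sphere (0 : EuclideanSpace ℝ (Fin (d+1))) 1, (1:ℝ) ∂μH[(d:ℝ)] := by
    rw [← set_int (fun _ => (1:ℝ))]
    simp [Measure.real]
  rw [hvol, set_int, set_int, set_int (fun ω => vb d 4 (2 * β / (1 + β^2)) ω ^ 2)]
  have cb := vb_cont (d := d) hb
  have cb' := vb_cont (d := d) hb'
  by_cases hinf : (μH[(d:ℝ)] : Measure (Metric.sphere (0 : EuclideanSpace ℝ (Fin (d+1))) 1)) Set.univ = ⊤
  · rw [int_zero hinf (fun x => (vb d 4 β x.1 + vb d 4 (-β) x.1)^4) ((cb.add cb').pow 4)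
        (fun x => pow_pos (add_pos (vb_pos hb x.1 (nS x)) (vb_pos hb' x.1 (nS x))) 4),
      int_zero hinf (fun _ => (1:ℝ)) continuous_const (fun _ => one_pos),
      int_zero hinf _ (vb_cont hg) (fun x => vb_pos hg x.1 (nS x)),
      int_zero hinf (fun x => vb d 4 (2 * β / (1 + β^2)) x.1 ^ 2) ((vb_cont hg).pow 2) (fun x => pow_pos (vb_pos hg x.1 (nS x)) 2)]
    ring
  · have : IsFiniteMeasure (μH[(d:ℝ)] : Measure (Metric.sphere (0 : EuclideanSpace ℝ (Fin (d+1))) 1)) :=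
      ⟨lt_top_iff_ne_top.2 hinf⟩
    have hint : ∀ f : Metric.sphere (0 : EuclideanSpace ℝ (Fin (d+1))) 1 → ℝ, Continuous f →
        Integrable f μH[(d:ℝ)] := fun f hf =>
      hf.integrable_of_hasCompactSupport (HasCompactSupport.of_compactSpace f)
    have m0 := main_k (d := d) hb 0 (by norm_num)
    have m1 := main_k (d := d) hb 1 (by norm_num)
    have m2 := main_k (d := d) hb 2 (by norm_num)
    have n0 := main_k (d := d) hb' 0 (by norm_num)
    have n1 := main_k (d := d) hb' 1 (by norm_num)
    have eg : -(2 * -β / (1 + (-β)^2)) = 2 * β / (1 + β^2) := by ring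
    rw [refl_k] at m1 m2
    rw [eg] at n1
    simp only [neg_neg, pow_zero, mul_one, pow_one, Nat.sub_zero] at m0 m1 m2 n0 n1
    norm_num only at m1 m2 n1
    have expand : ∀ x : Metric.sphere (0 : EuclideanSpace ℝ (Fin (d+1))) 1,
        (vb d 4 β x + vb d 4 (-β) x)^4 = vb d 4 β x ^ 4 + vb d 4 (-β) x ^ 4
          + 4 * (vb d 4 β x ^ 3 * vb d 4 (-β) x) + 4 * (vb d 4 (-β) x ^ 3 * vb d 4 β x)
          + 6 * (vb d 4 β x ^ 2 * vb d 4 (-β) x ^ 2) := fun x => by ring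
    simp_rw [expand]
    rw [integral_add (hint _ (by fun_prop)) (hint _ (by fun_prop)),
      integral_add (hint _ (by fun_prop)) (hint _ (by fun_prop)),
      integral_add (hint _ (by fun_prop)) (hint _ (by fun_prop)),
      integral_add (hint _ (by fun_prop)) (hint _ (by fun_prop)),
      integral_const_mul, integral_const_mul, integral_const_mul, m0, n0, m1, n1, m2]
    ring
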